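/- Let s ∈ {0,1}² and let f be a generator. Then 12 ∫_{[0,1]²} u₁ u₂ c_f^s(u₁,u₂) du₁ du₂ − 3 = (−1)^{s₁+s₂} (6 ∫₀¹ x(1−x) f(x) dx − 1). In other words, Spearman's rho of the bivariate copula with density c_f^s equals (−1)^{s₁+s₂}(6 E[X(1−X)] − 1), where X has density f. -/

import Mathlib

open MeasureTheory

/-- A generator: a probability density on `[0,1]`. -/
def IsGenerator (f : ℝ → ℝ) : Prop :=
  Measurable f ∧ (∀ x ∈ Set.Icc (0:ℝ) 1, 0 ≤ f x) ∧ ∫ x in Set.Icc (0:ℝ) 1, f x = 1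

/-- Reflection `x ↦ 1 - x` if the flag is set, the identity otherwise. -/
def reflectIf (b : Bool) : ℝ ≃ᵐ ℝ :=
  if b then MeasurableEquiv.subLeft 1 else MeasurableEquiv.refl ℝ

theorem reflectIf_apply (b : Bool) (x : ℝ) : reflectIf b x = if b then 1 - x else x := by
  cases b <;> rfl

theorem reflectIf_reflectIf (b : Bool) (x : ℝ) : reflectIf b (reflectIf b x) = x := by
  cases b <;> simp [reflectIf_apply]

theorem continuous_reflectIf (b : Bool) : Continuous (reflectIf b) := by
  have h : (reflectIf b : ℝ → ℝ) = fun x => if b then 1 - x else x :=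
    funext (reflectIf_apply b)
  rw [h]
  cases b <;> simp <;> fun_prop

theorem reflectIf_mem_Icc (b : Bool) {x : ℝ} (hx : x ∈ Set.Icc (0:ℝ) 1) :
    reflectIf b x ∈ Set.Icc (0:ℝ) 1 := by
  obtain ⟨h0, h1⟩ := hx
  cases b <;> simp [reflectIf_apply, h0, h1]

theorem norm_reflectIf_le_one (b : Bool) {x : ℝ} (hx : x ∈ Set.Icc (0:ℝ) 1) :
    ‖reflectIf b x‖ ≤ 1 := by
  have h := reflectIf_mem_Icc b hx
  rw [Real.norm_eq_abs, abs_of_nonneg h.1]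
  exact h.2

theorem measurePreserving_reflectIf (b : Bool) :
    MeasurePreserving (reflectIf b) (volume.restrict (Set.Icc (0:ℝ) 1))
      (volume.restrict (Set.Icc (0:ℝ) 1)) := by
  have h : MeasurePreserving (reflectIf b) volume volume := by
    cases b
    · exact MeasurePreserving.id volume
    · exact Measure.measurePreserving_sub_left volume 1
  have h' := h.restrict_preimage (measurableSet_Icc (a := (0:ℝ)) (b := 1))
  have hs : (reflectIf b) ⁻¹' Set.Icc (0:ℝ) 1 = Set.Icc 0 1 := by
    ext x
    refine ⟨fun hx => ?_, reflectIf_mem_Icc b⟩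
    rw [← reflectIf_reflectIf b x]
    exact reflectIf_mem_Icc b hx
  rwa [hs] at h'

theorem setIntegral_Icc_zero_one (g : ℝ → ℝ) :
    ∫ x in Set.Icc (0:ℝ) 1, g x = ∫ x in (0:ℝ)..1, g x := by
  rw [intervalIntegral.integral_of_le zero_le_one, integral_Icc_eq_integral_Ioc]

/-- Integrating a `1`-periodic function over a translate of the unit interval. -/
theorem Function.Periodic.intervalIntegral_add_left_zero_one {g : ℝ → ℝ}
    (hg : Function.Periodic g 1) (u : ℝ) :
    ∫ v in (0:ℝ)..1, g (u + v) = ∫ v in (0:ℝ)..1, g v := by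
  rw [intervalIntegral.integral_comp_add_left, add_zero, hg.intervalIntegral_add_eq u 0, zero_add]

theorem intervalIntegrable_comp_fract {f : ℝ → ℝ} (hf : IntegrableOn f (Set.Icc 0 1))
    (a b : ℝ) : IntervalIntegrable (fun x => f (Int.fract x)) volume a b := by
  have hp : Function.Periodic (fun x : ℝ => f (Int.fract x)) 1 :=
    (Int.fract_periodic ℝ).comp f
  refine hp.intervalIntegrable one_ne_zero (t := 0) ?_ a b
  rw [zero_add, intervalIntegrable_iff_integrableOn_Ioo_of_le zero_le_one]
  refine (hf.mono_set Set.Ioo_subset_Icc_self).congr_fun (fun x hx => ?_) measurableSet_Ioo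
  simp only [Int.fract_eq_self.2 ⟨hx.1.le, hx.2⟩]

theorem integrable_comp_fract_add {f : ℝ → ℝ} (hm : Measurable f)
    (hf : IntegrableOn f (Set.Icc 0 1)) :
    Integrable (fun z : ℝ × ℝ => f (Int.fract (z.1 + z.2)))
      ((volume.restrict (Set.Icc (0:ℝ) 1)).prod (volume.restrict (Set.Icc (0:ℝ) 1))) := by
  have hmeas : Measurable fun z : ℝ × ℝ => f (Int.fract (z.1 + z.2)) :=
    hm.comp (measurable_fract.comp (measurable_fst.add measurable_snd))
  rw [integrable_prod_iff hmeas.aestronglyMeasurable]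
  constructor
  · refine Filter.Eventually.of_forall fun u => ?_
    have h := (intervalIntegrable_comp_fract hf u (u + 1)).comp_add_left u
    simp only [sub_self, add_sub_cancel_left] at h
    exact (intervalIntegrable_iff_integrableOn_Icc_of_le zero_le_one).1 h
  · have hp : Function.Periodic (fun x : ℝ => ‖f (Int.fract x)‖) 1 :=
      (Int.fract_periodic ℝ).comp fun x => ‖f x‖
    simp only [setIntegral_Icc_zero_one, hp.intervalIntegral_add_left_zero_one]
    exact integrable_const _

theorem intervalIntegral_mul_comp_fract_add (b f : ℝ → ℝ) (u : ℝ) :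
    ∫ v in (0:ℝ)..1, b v * f (Int.fract (u + v)) =
      ∫ x in (0:ℝ)..1, b (Int.fract (x - u)) * f x := by
  have hp : Function.Periodic
      (fun x : ℝ => b (Int.fract (x - u)) * f (Int.fract x)) 1 := by
    intro x
    simp only [Int.fract_add_one, add_sub_right_comm]
  have h := hp.intervalIntegral_add_left_zero_one u
  simp only [add_sub_cancel_left] at h
  calc _ = ∫ v in (0:ℝ)..1, b (Int.fract v) * f (Int.fract (u + v)) := by
        refine intervalIntegral.integral_congr_uIoo fun x hx => ?_
        rw [Set.uIoo_of_le zero_le_one] at hx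
        simp only [Int.fract_eq_self.2 ⟨hx.1.le, hx.2⟩]
    _ = _ := h
    _ = _ := by
        refine intervalIntegral.integral_congr_uIoo fun x hx => ?_
        rw [Set.uIoo_of_le zero_le_one] at hx
        simp only [Int.fract_eq_self.2 ⟨hx.1.le, hx.2⟩]

theorem integral_prod_mul_comp_fract_add {a b f : ℝ → ℝ} (ha : Measurable a) (hb : Measurable b)
    (ha1 : ∀ x ∈ Set.Icc (0:ℝ) 1, ‖a x‖ ≤ 1) (hb1 : ∀ x ∈ Set.Icc (0:ℝ) 1, ‖b x‖ ≤ 1)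
    (hm : Measurable f) (hf : IntegrableOn f (Set.Icc 0 1)) :
    ∫ z : ℝ × ℝ, a z.1 * b z.2 * f (Int.fract (z.1 + z.2))
        ∂((volume.restrict (Set.Icc (0:ℝ) 1)).prod (volume.restrict (Set.Icc (0:ℝ) 1))) =
      ∫ x in Set.Icc (0:ℝ) 1, (∫ u in (0:ℝ)..1, a u * b (Int.fract (x - u))) * f x := by
  have hae : ∀ᵐ z : ℝ × ℝ ∂((volume.restrict (Set.Icc (0:ℝ) 1)).prod
      (volume.restrict (Set.Icc (0:ℝ) 1))), z ∈ Set.Icc (0:ℝ) 1 ×ˢ Set.Icc (0:ℝ) 1 := by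
    rw [Measure.prod_restrict]
    exact ae_restrict_mem (measurableSet_Icc.prod measurableSet_Icc)
  have hmul {p q : ℝ} (hp : ‖p‖ ≤ 1) (hq : ‖q‖ ≤ 1) : ‖p * q‖ ≤ 1 := by
    rw [norm_mul]
    exact mul_le_one₀ hp (norm_nonneg _) hq
  have h1 : Integrable (fun z : ℝ × ℝ => a z.1 * b z.2 * f (Int.fract (z.1 + z.2)))
      ((volume.restrict (Set.Icc (0:ℝ) 1)).prod (volume.restrict (Set.Icc (0:ℝ) 1))) := by
    refine (integrable_comp_fract_add hm hf).bdd_mul (c := 1)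
      (Measurable.aestronglyMeasurable (by fun_prop)) ?_
    filter_upwards [hae] with z hz
    exact hmul (ha1 _ hz.1) (hb1 _ hz.2)
  have h2 : Integrable (Function.uncurry fun u x => a u * b (Int.fract (x - u)) * f x)
      ((volume.restrict (Set.Icc (0:ℝ) 1)).prod (volume.restrict (Set.Icc (0:ℝ) 1))) := by
    refine (Integrable.comp_snd hf _).bdd_mul (c := 1) (Measurable.aestronglyMeasurable ?_) ?_
    · exact (ha.comp measurable_fst).mul
        (hb.comp (measurable_fract.comp (measurable_snd.sub measurable_fst)))
    · filter_upwards [hae] with z hz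
      exact hmul (ha1 _ hz.1) (hb1 _ ⟨Int.fract_nonneg _, (Int.fract_lt_one _).le⟩)
  rw [integral_prod _ h1]
  calc _ = ∫ u in Set.Icc (0:ℝ) 1, ∫ x in Set.Icc (0:ℝ) 1,
          a u * b (Int.fract (x - u)) * f x := by
        congr 1 with u
        simp only [mul_assoc, integral_const_mul, setIntegral_Icc_zero_one,
          intervalIntegral_mul_comp_fract_add]
    _ = _ := by
        rw [integral_integral_swap h2]
        simp only [integral_mul_const, setIntegral_Icc_zero_one]

theorem intervalIntegral_mul_comp_fract_sub {a b : ℝ → ℝ} (ha : Continuous a) (hb : Continuous b)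
    {x : ℝ} (hx : x ∈ Set.Ioo (0:ℝ) 1) :
    ∫ u in (0:ℝ)..1, a u * b (Int.fract (x - u)) =
      (∫ u in (0:ℝ)..x, a u * b (x - u)) + ∫ u in x..1, a u * b (x - u + 1) := by
  have e1 : Set.EqOn (fun u => a u * b (x - u)) (fun u => a u * b (Int.fract (x - u)))
      (Set.uIoo 0 x) := by
    intro u hu
    rw [Set.uIoo_of_le hx.1.le] at hu
    have : Int.fract (x - u) = x - u :=
      Int.fract_eq_self.2 ⟨by linarith [hu.2], by linarith [hu.1, hx.2]⟩
    simp only [this]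
  have e2 : Set.EqOn (fun u => a u * b (x - u + 1)) (fun u => a u * b (Int.fract (x - u)))
      (Set.uIoo x 1) := by
    intro u hu
    rw [Set.uIoo_of_le hx.2.le] at hu
    have : Int.fract (x - u) = x - u + 1 := by
      rw [← Int.fract_add_one]
      exact Int.fract_eq_self.2 ⟨by linarith [hu.2, hx.1], by linarith [hu.1]⟩
    simp only [this]
  have c1 : Continuous fun u => a u * b (x - u) := by fun_prop
  have c2 : Continuous fun u => a u * b (x - u + 1) := by fun_prop
  rw [intervalIntegral.integral_congr_uIoo e1, intervalIntegral.integral_congr_uIoo e2,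
    intervalIntegral.integral_add_adjacent_intervals]
  · exact (c1.intervalIntegrable 0 x).congr_uIoo e1
  · exact (c2.intervalIntegrable x 1).congr_uIoo e2

theorem intervalIntegral_quadratic (p q c d e : ℝ) :
    ∫ u in p..q, (c + d * u + e * u ^ 2) =
      c * (q - p) + d * (q ^ 2 - p ^ 2) / 2 + e * (q ^ 3 - p ^ 3) / 3 := by
  have h : ∀ u ∈ Set.uIcc p q, HasDerivAt
      (fun u : ℝ => c * u + d * u ^ 2 / 2 + e * u ^ 3 / 3) (c + d * u + e * u ^ 2) u := by
    intro u _
    refine HasDerivAt.congr_deriv ((((hasDerivAt_id u).const_mul c).add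
      (((hasDerivAt_pow 2 u).const_mul d).div_const 2)).add
      (((hasDerivAt_pow 3 u).const_mul e).div_const 3)) ?_
    norm_num
    ring
  rw [intervalIntegral.integral_eq_sub_of_hasDerivAt h
    ((by fun_prop : Continuous fun u : ℝ => c + d * u + e * u ^ 2).intervalIntegrable p q)]
  ring

/-- The conditional mean of the product of the coordinates, given that their sum is `x` mod `1`. -/
theorem intervalIntegral_reflectIf_mul_reflectIf (b c : Bool) {x : ℝ}
    (hx : x ∈ Set.Ioo (0:ℝ) 1) :
    ∫ u in (0:ℝ)..1, reflectIf b u * reflectIf c (Int.fract (x - u)) =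
      (-1 : ℝ) ^ (((if b then 1 else 0) + (if c then 1 else 0) : ℕ)) *
        (x * (1 - x) / 2 - 1 / 12) + 1 / 4 := by
  rw [intervalIntegral_mul_comp_fract_sub (continuous_reflectIf b) (continuous_reflectIf c) hx]
  have key (g : ℝ → ℝ) (p q k d e : ℝ) (h : ∀ u, g u = k + d * u + e * u ^ 2) :
      ∫ u in p..q, g u = k * (q - p) + d * (q ^ 2 - p ^ 2) / 2 + e * (q ^ 3 - p ^ 3) / 3 := by
    rw [funext h, intervalIntegral_quadratic]
  cases b <;> cases c <;> simp only [reflectIf_apply, if_true, if_false, Bool.false_eq_true]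
  · rw [key _ 0 x 0 x (-1) fun u => by ring, key _ x 1 0 (x + 1) (-1) fun u => by ring]
    ring
  · rw [key _ 0 x 0 (1 - x) 1 fun u => by ring, key _ x 1 0 (-x) 1 fun u => by ring]
    ring
  · rw [key _ 0 x x (-1 - x) 1 fun u => by ring, key _ x 1 (x + 1) (-2 - x) 1 fun u => by ring]
    ring
  · rw [key _ 0 x (1 - x) x (-1) fun u => by ring, key _ x 1 (-x) (1 + x) (-1) fun u => by ring]
    ring

theorem setIntegral_pi_fin_two (g : ℝ → ℝ → ℝ) :
    ∫ u in Set.univ.pi (fun _ : Fin 2 => Set.Icc (0:ℝ) 1), g (u 0) (u 1) =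
      ∫ z : ℝ × ℝ, g z.1 z.2
        ∂((volume.restrict (Set.Icc (0:ℝ) 1)).prod (volume.restrict (Set.Icc (0:ℝ) 1))) := by
  rw [Measure.prod_restrict, ← Measure.volume_eq_prod,
    ← (volume_preserving_finTwoArrow ℝ).setIntegral_preimage_emb
      MeasurableEquiv.finTwoArrow.measurableEmbedding]
  have hs : (Set.univ.pi fun _ : Fin 2 => Set.Icc (0:ℝ) 1) =
      MeasurableEquiv.finTwoArrow ⁻¹' (Set.Icc (0:ℝ) 1 ×ˢ Set.Icc (0:ℝ) 1) := by
    ext u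
    simp only [Set.mem_pi, Set.mem_univ, true_imp_iff, Fin.forall_fin_two, Set.mem_preimage,
      Set.mem_prod]
    rfl
  rw [hs]
  rfl

theorem stmt_7 (s : Fin 2 → Bool) (f : ℝ → ℝ) (hf : IsGenerator f) :
    12 * (∫ u in Set.univ.pi (fun _ : Fin 2 => Set.Icc (0:ℝ) 1),
        u 0 * u 1 *
          f (Int.fract ((if s 0 then 1 - u 0 else u 0) + (if s 1 then 1 - u 1 else u 1)))) - 3
    = (-1 : ℝ) ^ (((if s 0 then 1 else 0) + (if s 1 then 1 else 0) : ℕ)) *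
        (6 * (∫ x in Set.Icc (0:ℝ) 1, x * (1 - x) * f x) - 1) := by
  obtain ⟨hm, -, hone⟩ := hf
  have hint : IntegrableOn f (Set.Icc 0 1) := by
    by_contra h
    rw [integral_undef h] at hone
    exact zero_ne_one hone
  have hint2 : IntegrableOn (fun x => x * (1 - x) * f x) (Set.Icc 0 1) :=
    hint.continuousOn_mul (by fun_prop) isCompact_Icc
  have hmp := (measurePreserving_reflectIf (s 0)).prod (measurePreserving_reflectIf (s 1))
  have hswap := hmp.integral_comp
    ((reflectIf (s 0)).prodCongr (reflectIf (s 1))).measurableEmbedding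
    fun z : ℝ × ℝ => reflectIf (s 0) z.1 * reflectIf (s 1) z.2 * f (Int.fract (z.1 + z.2))
  simp only [Prod.map_fst, Prod.map_snd, reflectIf_reflectIf] at hswap
  simp only [← reflectIf_apply]
  rw [setIntegral_pi_fin_two fun u v =>
      u * v * f (Int.fract (reflectIf (s 0) u + reflectIf (s 1) v)), hswap,
    integral_prod_mul_comp_fract_add (reflectIf (s 0)).measurable (reflectIf (s 1)).measurable
      (fun _ => norm_reflectIf_le_one _) (fun _ => norm_reflectIf_le_one _) hm hint]
  set σ : ℝ := (-1 : ℝ) ^ (((if s 0 then 1 else 0) + (if s 1 then 1 else 0) : ℕ)) with hσ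
  have hlin : ∫ x in Set.Icc (0:ℝ) 1,
      (∫ u in (0:ℝ)..1, reflectIf (s 0) u * reflectIf (s 1) (Int.fract (x - u))) * f x =
      σ / 2 * (∫ x in Set.Icc (0:ℝ) 1, x * (1 - x) * f x) + (1 / 4 - σ / 12) := by
    calc _ = ∫ x in Set.Icc (0:ℝ) 1,
          (σ / 2 * (x * (1 - x) * f x) + (1 / 4 - σ / 12) * f x) := by
          rw [integral_Icc_eq_integral_Ioo, integral_Icc_eq_integral_Ioo]
          refine setIntegral_congr_fun measurableSet_Ioo fun x hx => ?_
          simp only [intervalIntegral_reflectIf_mul_reflectIf _ _ hx, ← hσ]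
          ring
      _ = _ := by
          rw [integral_add (hint2.const_mul _) (hint.const_mul _), integral_const_mul,
            integral_const_mul, hone, mul_one]
  rw [hlin]
  ring
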